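/- arXiv:1501.04352 — 2 statements merged into one kernel-verified Lean document; each statement's English description precedes it below -/
import Mathlib

section
/- For every k ≥ 1, the primal iterates satisfy ‖u^k − u∞‖ ≤ a·√(L/μ)·‖λ⁰ − λ∞‖ / (k + a − 1), i.e., the primal sequence converges strongly to the primal optimizer with rate O(1/k). -/
open scoped RealInnerProductSpace

section InnerProductSpace

variable {E : Type*} [NormedAddCommGroup E] [InnerProductSpace ℝ E]

/-- Quadratic growth of a strongly convex function around a minimizer. -/
lemma StrongConvexOn.add_half_mul_sq_norm_sub_le {s : Set E} {m : ℝ} {φ : E → ℝ}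
    (hφ : StrongConvexOn s m φ) {x y : E} (hx : x ∈ s) (hy : y ∈ s) (hmin : IsMinOn φ s x) :
    φ x + m / 2 * ‖x - y‖ ^ 2 ≤ φ y := by
  have key : ∀ r ∈ Set.Ioo (0 : ℝ) 1, r * (m / 2 * ‖x - y‖ ^ 2) ≤ φ y - φ x := by
    intro r ⟨hr0, hr1⟩
    have h1 := hφ.2 hx hy hr0.le (sub_nonneg.2 hr1.le) (by ring)
    have h2 := isMinOn_iff.1 hmin _
      (hφ.1 hx hy hr0.le (sub_nonneg.2 hr1.le) (by ring : r + (1 - r) = 1))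
    simp only [smul_eq_mul] at h1
    have h3 : 0 < 1 - r := by linarith
    refine le_of_mul_le_mul_left ?_ h3
    linarith
  have hlim : Filter.Tendsto (fun r : ℝ => r * (m / 2 * ‖x - y‖ ^ 2)) (nhdsWithin 1 (Set.Iio 1))
      (nhds (1 * (m / 2 * ‖x - y‖ ^ 2))) :=
    ((continuous_id.mul continuous_const).tendsto _).mono_left nhdsWithin_le_nhds
  have := le_of_tendsto hlim
    (Filter.mem_of_superset (Ioo_mem_nhdsLT zero_lt_one) key)
  linarith

/-- Variational inequality for a nearest point of a convex set. -/
lemma Convex.inner_sub_sub_nonpos_of_forall_norm_sub_le {K : Set E} (hK : Convex ℝ K) {y p z : E}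
    (hp : p ∈ K) (hmin : ∀ z ∈ K, ‖y - p‖ ≤ ‖y - z‖) (hz : z ∈ K) : ⟪y - p, z - p⟫ ≤ 0 := by
  have : Nonempty K := ⟨⟨p, hp⟩⟩
  refine (norm_eq_iInf_iff_real_inner_le_zero hK hp).1 (le_antisymm ?_ ?_) z hz
  · exact le_ciInf fun w => hmin w w.2
  · exact ciInf_le (f := fun w : K => ‖y - w‖) ⟨0, by rintro _ ⟨w, rfl⟩; exact norm_nonneg _⟩
      ⟨p, hp⟩

/-- Energy decrease along one extrapolated step with momentum parameter `t`. -/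
lemma accelerated_step_energy_le {K : Set E} {h : E → ℝ} (hK : Convex ℝ K)
    (hconv : ConvexOn ℝ Set.univ h) {L t : ℝ} (ht : 1 ≤ t) {x x' y v w : E} (hx : x ∈ K) (hw : w ∈ K)
    (hstep : ∀ z ∈ K, h x' ≤ h z + L / 2 * (‖y - z‖ ^ 2 - ‖x' - z‖ ^ 2))
    (hv : t • y = (t - 1) • x + v) :
    t ^ 2 * (h x' - h w) + L / 2 * ‖t • x' - (t - 1) • x - w‖ ^ 2 ≤
      (t ^ 2 - t) * (h x - h w) + L / 2 * ‖v - w‖ ^ 2 := by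
  have ht0 : 0 < t := by linarith
  set z := (1 - 1 / t) • x + (1 / t) • w with hz
  have hc1 : 0 ≤ 1 - 1 / t := by rw [sub_nonneg, div_le_one ht0]; exact ht
  have hc2 : 0 ≤ 1 / t := by positivity
  have h1 := hstep z (hK hx hw hc1 hc2 (by ring))
  have h2 := hconv.2 (Set.mem_univ x) (Set.mem_univ w) hc1 hc2 (by ring)
  rw [← hz] at h2
  simp only [smul_eq_mul] at h2
  have htz : t • z = (t - 1) • x + w := by
    rw [hz, smul_add, smul_smul, smul_smul, mul_sub, mul_one_div_cancel ht0.ne', mul_one, one_smul]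
  have hsq : ∀ q : E, ‖t • q - t • z‖ ^ 2 = t ^ 2 * ‖q - z‖ ^ 2 := by
    intro q
    rw [← smul_sub, norm_smul, mul_pow, Real.norm_eq_abs, sq_abs]
  have h3 : ‖v - w‖ ^ 2 = t ^ 2 * ‖y - z‖ ^ 2 := by
    rw [← hsq, htz, hv]; congr 2; abel
  have h4 : ‖t • x' - (t - 1) • x - w‖ ^ 2 = t ^ 2 * ‖x' - z‖ ^ 2 := by
    rw [← hsq, htz]; congr 2; abel
  rw [h3, h4]
  have h5 := mul_le_mul_of_nonneg_left (h1.trans (add_le_add_left h2 _)) (sq_nonneg t)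
  have h6 : t ^ 2 * ((1 - 1 / t) * h x + 1 / t * h w) = (t ^ 2 - t) * h x + t * h w := by
    field_simp
  linarith

variable [CompleteSpace E] {h : E → ℝ} {g : E → E}

lemma HasGradientAt.hasDerivAt_comp_add_smul {x d : E} {r : ℝ} {g' : E}
    (hg : HasGradientAt h g' (x + r • d)) :
    HasDerivAt (fun r : ℝ => h (x + r • d)) ⟪g', d⟫ r := by
  have hline : HasDerivAt (fun r : ℝ => x + r • d) d r := by
    simpa using ((hasDerivAt_id r).smul_const d).const_add x
  simpa [Function.comp_def] using hg.hasFDerivAt.comp_hasDerivAt r hline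

lemma ConvexOn.add_inner_gradient_le (hconv : ConvexOn ℝ Set.univ h) {x g' : E}
    (hg : HasGradientAt h g' x) (y : E) : h x + ⟪g', y - x⟫ ≤ h y := by
  have hder : HasDerivAt (fun r : ℝ => h (x + r • (y - x))) ⟪g', y - x⟫ 0 :=
    HasGradientAt.hasDerivAt_comp_add_smul (by simpa using hg)
  have hcv : ConvexOn ℝ Set.univ (fun r : ℝ => h (x + r • (y - x))) := by
    have := hconv.comp_affineMap (AffineMap.lineMap (k := ℝ) x y)
    simpa [Function.comp_def, AffineMap.lineMap_apply, add_comm] using this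
  have := hcv.le_slope_of_hasDerivAt (Set.mem_univ 0) (Set.mem_univ 1) zero_lt_one hder
  simp [slope_def_field] at this
  linarith

/-- Descent lemma for functions with Lipschitz gradient. -/
lemma le_add_inner_add_sq_norm_of_lipschitz_gradient {L : ℝ} (hg : ∀ x, HasGradientAt h (g x) x)
    (hLip : ∀ x y, ‖g x - g y‖ ≤ L * ‖x - y‖) (x y : E) :
    h y ≤ h x + ⟪g x, y - x⟫ + L / 2 * ‖y - x‖ ^ 2 := by
  set d := y - x with hd
  have hder : ∀ r : ℝ, HasDerivAt
      (fun r : ℝ => h (x + r • d) - (r * ⟪g x, d⟫ + r ^ 2 * (L / 2 * ‖d‖ ^ 2)))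
      (⟪g (x + r • d), d⟫ - (1 * ⟪g x, d⟫ + (2 * r) * (L / 2 * ‖d‖ ^ 2))) r := by
    intro r
    refine (hg _).hasDerivAt_comp_add_smul.sub
      (((hasDerivAt_id r).mul_const _).add (HasDerivAt.mul_const ?_ _))
    simpa using hasDerivAt_pow 2 r
  have hanti := antitoneOn_of_hasDerivWithinAt_nonpos (convex_Icc (0 : ℝ) 1)
    (fun r _ => (hder r).continuousAt.continuousWithinAt)
    (fun r _ => (hder r).hasDerivWithinAt) (by
      intro r hr
      have hr0 : 0 ≤ r := (interior_subset hr).1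
      have h1 : ⟪g (x + r • d) - g x, d⟫ ≤ L * (r * ‖d‖) * ‖d‖ := by
        refine (real_inner_le_norm _ _).trans ?_
        gcongr
        simpa [norm_smul, abs_of_nonneg hr0] using hLip (x + r • d) x
      rw [inner_sub_left] at h1
      linarith)
  have := hanti (Set.left_mem_Icc.2 zero_le_one) (Set.right_mem_Icc.2 zero_le_one) zero_le_one
  simp [hd] at this
  simp only [hd]
  linarith

/-- Three-point inequality for one projected gradient step with step size `1 / L`. -/
lemma projected_gradient_step_le {K : Set E} (hK : Convex ℝ K) (hconv : ConvexOn ℝ Set.univ h)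
    (hg : ∀ x, HasGradientAt h (g x) x) {L : ℝ} (hL : 0 < L)
    (hLip : ∀ x y, ‖g x - g y‖ ≤ L * ‖x - y‖) {y p : E} (hp : p ∈ K)
    (hpmin : ∀ z ∈ K, ‖y - (1 / L) • g y - p‖ ≤ ‖y - (1 / L) • g y - z‖) {z : E} (hz : z ∈ K) :
    h p ≤ h z + L / 2 * (‖y - z‖ ^ 2 - ‖p - z‖ ^ 2) := by
  have h1 := le_add_inner_add_sq_norm_of_lipschitz_gradient hg hLip y p
  have h2 := hconv.add_inner_gradient_le (hg y) z
  have h3 : ⟪y - p, z - p⟫ - 1 / L * ⟪g y, z - p⟫ ≤ 0 := by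
    rw [← real_inner_smul_left, ← inner_sub_left, sub_right_comm]
    exact hK.inner_sub_sub_nonpos_of_forall_norm_sub_le hp hpmin hz
  have h4 : L * ⟪y - p, z - p⟫ ≤ ⟪g y, z - p⟫ := by
    have := mul_nonpos_of_nonneg_of_nonpos hL.le h3
    field_simp at this
    linarith
  have h5 : ⟪g y, z - p⟫ = ⟪g y, z - y⟫ - ⟪g y, p - y⟫ := by
    rw [← inner_sub_right]; simp
  have h6 : ‖y - z‖ ^ 2 = ‖p - y‖ ^ 2 - 2 * ⟪y - p, z - p⟫ + ‖p - z‖ ^ 2 := by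
    rw [← norm_sub_rev y p, ← norm_sub_rev z p, ← norm_sub_sq_real]; simp
  rw [h6]
  linarith

end InnerProductSpace

/-- Strong convergence of the primal AFBS iterates with rate `O(1/k)`:
`‖u^k − u∞‖ ≤ a·√(L/μ)·‖λ⁰ − λ∞‖ / (k + a − 1)` for all `k ≥ 1`. -/
theorem afbs_primal_rate
    {Hu Hl : Type*} [NormedAddCommGroup Hu] [InnerProductSpace ℝ Hu] [CompleteSpace Hu]
    [NormedAddCommGroup Hl] [InnerProductSpace ℝ Hl] [CompleteSpace Hl]
    (μ : ℝ) (hμ : 0 < μ)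
    (f : Hu → ℝ)
    (hf : ConvexOn ℝ Set.univ (fun u => f u - μ / 2 * ‖u‖ ^ 2))
    (C : Hu →L[ℝ] Hl) (c : Hl)
    (K : Set Hl) (hKne : K.Nonempty) (hKcl : IsClosed K) (hKcv : Convex ℝ K)
    (Lag : Hu → Hl → ℝ)
    (hLag : ∀ v lam, Lag v lam = f v + ⟪lam, c - C v⟫)
    -- the unique minimizer of the Lagrangian in its first argument
    (u : Hl → Hu)
    (humin : ∀ lam : Hl, ∀ v : Hu, Lag (u lam) lam ≤ Lag v lam)
    (huniq : ∀ lam : Hl, ∀ v : Hu, (∀ v' : Hu, Lag v lam ≤ Lag v' lam) → v = u lam)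
    -- the dual objective and its smoothness
    (h : Hl → ℝ)
    (hdef : ∀ lam, h lam = -(Lag (u lam) lam))
    (hconv : ConvexOn ℝ Set.univ h)
    (g : Hl → Hl) (hgrad : ∀ x, HasGradientAt h (g x) x)
    (L : ℝ) (hL : 0 < L) (hLip : ∀ x y, ‖g x - g y‖ ≤ L * ‖x - y‖)
    -- the saddle point
    (uinf : Hu) (laminf : Hl) (hinfK : laminf ∈ K)
    (hsaddle1 : ∀ v : Hu, Lag uinf laminf ≤ Lag v laminf)
    (hsaddle2 : ∀ lam ∈ K, Lag uinf lam ≤ Lag uinf laminf)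
    (hinfmin : ∀ z ∈ K, h laminf ≤ h z)
    -- projection onto K
    (P : Hl → Hl)
    (hPmem : ∀ y, P y ∈ K)
    (hPmin : ∀ y, ∀ z ∈ K, ‖y - P y‖ ≤ ‖y - z‖)
    -- AFBS iterates
    (a : ℝ) (ha : 2 < a)
    (lam lamhat : ℕ → Hl)
    (hhat0 : lamhat 0 = lam 0)
    (hhat : ∀ k : ℕ, 1 ≤ k →
      lamhat k = lam k + (((k : ℝ) - 1) / ((k : ℝ) + a)) • (lam k - lam (k - 1)))
    (hupd : ∀ k : ℕ, lam (k + 1) = P (lamhat k - (1 / L) • g (lamhat k))) :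
    ∀ k : ℕ, 1 ≤ k →
      ‖u (lam k) - uinf‖ ≤
        a * Real.sqrt (L / μ) * ‖lam 0 - laminf‖ / ((k : ℝ) + a - 1) := by
  have hstep : ∀ k, ∀ z ∈ K, h (lam (k + 1)) ≤
      h z + L / 2 * (‖lamhat k - z‖ ^ 2 - ‖lam (k + 1) - z‖ ^ 2) := by
    intro k z hz
    rw [hupd]
    exact projected_gradient_step_le hKcv hconv hgrad hL hLip (hPmem _) (hPmin _) hz
  have hmem : ∀ k, lam (k + 1) ∈ K := fun k => hupd k ▸ hPmem _
  have ha0 : 0 < a := by linarith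
  have energy : ∀ n : ℕ,
      (((n : ℝ) + a) / a) ^ 2 * (h (lam (n + 1)) - h laminf) +
        L / 2 * ‖(((n : ℝ) + a) / a) • lam (n + 1) - (((n : ℝ) + a) / a - 1) • lam n - laminf‖ ^ 2
        ≤ L / 2 * ‖lam 0 - laminf‖ ^ 2 := by
    intro n
    induction n with
    | zero =>
      have := hstep 0 laminf hinfK
      rw [hhat0] at this
      simp [ha0.ne'] at this ⊢
      linarith
    | succ n ih =>
      set s : ℝ := ((n : ℝ) + a) / a with hs
      set t : ℝ := (((n + 1 : ℕ) : ℝ) + a) / a with ht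
      have hn : (0 : ℝ) ≤ n := n.cast_nonneg
      have ht1 : 1 ≤ t := by
        rw [ht, one_le_div ha0]; push_cast; linarith
      have hts : t ^ 2 - t ≤ s ^ 2 := by
        rw [hs, ht]
        push_cast
        have hdiff : ((n + a) / a) ^ 2 - (((n + 1 + a) / a) ^ 2 - (n + 1 + a) / a)
            = (n * (a - 2) + (a ^ 2 - a - 1)) / a ^ 2 := by
          field_simp
          ring
        rw [← sub_nonneg, hdiff]
        exact div_nonneg (add_nonneg (mul_nonneg hn (by linarith)) (by nlinarith)) (sq_nonneg a)
      have hv : t • lamhat (n + 1) =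
          (t - 1) • lam (n + 1) + (s • lam (n + 1) - (s - 1) • lam n) := by
        have hc : t * ((((n + 1 : ℕ) : ℝ) - 1) / (((n + 1 : ℕ) : ℝ) + a)) = s - 1 := by
          rw [hs, ht]
          push_cast
          field_simp
          ring
        rw [hhat (n + 1) (by omega), smul_add, smul_smul, hc, Nat.add_sub_cancel]
        module
      have h1 := accelerated_step_energy_le hKcv hconv ht1 (hmem n) hinfK (hstep (n + 1)) hv
      have h2 := mul_le_mul_of_nonneg_right hts (sub_nonneg.2 (hinfmin _ (hmem n)))
      linarith
  intro k hk
  obtain ⟨n, rfl⟩ := Nat.exists_eq_add_of_le' hk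
  have hgrowth : μ / 2 * ‖u (lam (n + 1)) - uinf‖ ^ 2 ≤ h (lam (n + 1)) - h laminf := by
    have hsc : StrongConvexOn Set.univ μ (fun v => Lag v (lam (n + 1))) := by
      rw [strongConvexOn_iff_convex]
      have hlin : ConvexOn ℝ Set.univ (fun v => ⟪lam (n + 1), c - C v⟫) := by
        refine ⟨convex_univ, fun x _ y _ p q _ _ hpq => le_of_eq ?_⟩
        simp only [inner_sub_right, map_add, map_smul, inner_add_right, inner_smul_right,
          smul_eq_mul]
        linear_combination (-⟪lam (n + 1), c⟫) * hpq
      refine (hf.add hlin).congr fun v _ => ?_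
      simp only [Pi.add_apply, hLag]
      ring
    have h1 := hsc.add_half_mul_sq_norm_sub_le (Set.mem_univ (u (lam (n + 1))))
      (Set.mem_univ uinf) (fun v _ => humin _ v)
    have h2 := hsaddle2 _ (hmem n)
    have h3 := hsaddle1 (u laminf)
    rw [hdef, hdef]
    linarith
  have hn : (0 : ℝ) ≤ n := n.cast_nonneg
  have hna : 0 < (n : ℝ) + a := by linarith
  have hbound : (((n : ℝ) + a) / a) ^ 2 * (μ / 2 * ‖u (lam (n + 1)) - uinf‖ ^ 2) ≤
      L / 2 * ‖lam 0 - laminf‖ ^ 2 := by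
    have h1 := energy n
    have h2 := mul_le_mul_of_nonneg_left hgrowth (sq_nonneg (((n : ℝ) + a) / a))
    have h3 : 0 ≤ L / 2 * ‖(((n : ℝ) + a) / a) • lam (n + 1) -
      (((n : ℝ) + a) / a - 1) • lam n - laminf‖ ^ 2 := by positivity
    linarith
  have hden : (((n + 1 : ℕ) : ℝ) + a - 1) = n + a := by push_cast; ring
  rw [hden, le_div_iff₀ hna]
  refine le_of_sq_le_sq ?_ (by positivity)
  rw [mul_pow, mul_pow, mul_pow, Real.sq_sqrt (by positivity)]
  field_simp at hbound ⊢
  linarith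
end

section
/- For every k ≥ 1, the AFBS iterates generated with the backtracking stepsizes satisfy h(λ^k) − h(λ∞) ≤ a²·L̄·‖λ⁰ − λ∞‖² / (2·(k + a − 1)²), where L̄ := sup_k L^k. -/
open scoped RealInnerProductSpace

/-- First-order characterization of convexity on a Hilbert space. -/
theorem ConvexOn.add_inner_gradient_le_s12
    {H : Type*} [NormedAddCommGroup H] [InnerProductSpace ℝ H] [CompleteSpace H]
    {f : H → ℝ} (hf : ConvexOn ℝ Set.univ f) {x f' : H} (hx : HasGradientAt f f' x) (z : H) :
    f x + ⟪f', z - x⟫ ≤ f z := by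
  have hc : ConvexOn ℝ Set.univ (f ∘ AffineMap.lineMap (k := ℝ) x z) := by
    simpa using hf.comp_affineMap (AffineMap.lineMap (k := ℝ) x z)
  have hd : HasDerivAt (f ∘ AffineMap.lineMap (k := ℝ) x z) ⟪f', z - x⟫ 0 := by
    have hl : HasDerivAt (AffineMap.lineMap (k := ℝ) x z) (z - x) (0 : ℝ) :=
      AffineMap.hasDerivAt_lineMap
    have hx' : HasFDerivAt f (InnerProductSpace.toDual ℝ H f')
        (AffineMap.lineMap (k := ℝ) x z (0 : ℝ)) := by
      simpa using hx.hasFDerivAt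
    simpa using hx'.comp_hasDerivAt (0 : ℝ) hl
  have hs := hc.le_slope_of_hasDerivAt (Set.mem_univ 0) (Set.mem_univ 1) zero_lt_one hd
  simp only [slope_def_field, Function.comp_apply, AffineMap.lineMap_apply_zero,
    AffineMap.lineMap_apply_one] at hs
  linarith

/-- The variational inequality satisfied by a nearest point of a convex set. -/
theorem Convex.inner_sub_le_zero_of_forall_norm_sub_le
    {H : Type*} [NormedAddCommGroup H] [InnerProductSpace ℝ H]
    {K : Set H} (hK : Convex ℝ K) {y p : H} (hp : p ∈ K)
    (hmin : ∀ z ∈ K, ‖y - p‖ ≤ ‖y - z‖) {z : H} (hz : z ∈ K) :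
    ⟪y - p, z - p⟫ ≤ 0 := by
  have : Nonempty K := ⟨⟨p, hp⟩⟩
  refine (norm_eq_iInf_iff_real_inner_le_zero hK hp).1 (le_antisymm ?_ ?_) z hz
  · exact le_ciInf fun w => hmin w w.2
  · exact ciInf_le (f := fun w : K => ‖y - w‖) ⟨0, by rintro _ ⟨w, rfl⟩; positivity⟩ ⟨p, hp⟩

/-- The fundamental inequality of a projected gradient step with sufficient descent. -/
theorem projected_gradient_step_le_s12
    {H : Type*} [NormedAddCommGroup H] [InnerProductSpace ℝ H] [CompleteSpace H]
    {K : Set H} (hK : Convex ℝ K) {f : H → ℝ} (hf : ConvexOn ℝ Set.univ f)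
    {y f' p : H} (hy : HasGradientAt f f' y) {L : ℝ} (hL : 0 < L) (hp : p ∈ K)
    (hmin : ∀ z ∈ K, ‖y - (1 / L) • f' - p‖ ≤ ‖y - (1 / L) • f' - z‖)
    (hdesc : f p ≤ f y + ⟪p - y, f'⟫ + L / 2 * ‖p - y‖ ^ 2) {z : H} (hz : z ∈ K) :
    f p - f z ≤ L / 2 * (‖y - z‖ ^ 2 - ‖p - z‖ ^ 2) := by
  have hgrad := hf.add_inner_gradient_le_s12 hy z
  have hproj := hK.inner_sub_le_zero_of_forall_norm_sub_le hp hmin hz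
  have hscaled : L * ⟪y - p, z - p⟫ ≤ ⟪f', z - p⟫ := by
    rw [sub_right_comm, inner_sub_left, real_inner_smul_left] at hproj
    have := mul_nonpos_of_nonneg_of_nonpos hL.le hproj
    rw [mul_sub, ← mul_assoc, mul_one_div_cancel hL.ne', one_mul] at this
    linarith
  have hsplit : ⟪p - y, f'⟫ - ⟪f', z - y⟫ = -⟪f', z - p⟫ := by
    rw [real_inner_comm, ← inner_sub_right, ← inner_neg_right]
    congr 1
    abel
  have hnorm : ‖y - z‖ ^ 2 - ‖p - z‖ ^ 2 = ‖p - y‖ ^ 2 - 2 * ⟪y - p, z - p⟫ := by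
    have h₁ : y - z = (y - p) - (z - p) := by abel
    rw [h₁, norm_sub_sq_real, norm_sub_rev z p, norm_sub_rev p y]
    ring
  rw [hnorm]
  linarith

/-- Combining the step inequalities at `x` and `s` with extrapolation parameter `t`. -/
theorem extrapolated_step_le
    {H : Type*} [NormedAddCommGroup H] [InnerProductSpace ℝ H]
    {x y p s : H} {vx vp L t : ℝ} (ht : 1 ≤ t)
    (hx : vp - vx ≤ L / 2 * (‖y - x‖ ^ 2 - ‖p - x‖ ^ 2))
    (hs : vp ≤ L / 2 * (‖y - s‖ ^ 2 - ‖p - s‖ ^ 2)) :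
    t ^ 2 * vp ≤ (t ^ 2 - t) * vx +
      L / 2 * (‖x + t • (y - x) - s‖ ^ 2 - ‖x + t • (p - x) - s‖ ^ 2) := by
  have key (w : H) : ‖x + t • (w - x) - s‖ ^ 2 =
      t * ((t - 1) * ‖w - x‖ ^ 2 + ‖w - s‖ ^ 2) - (t - 1) * ‖x - s‖ ^ 2 := by
    have h₁ : x + t • (w - x) - s = t • (w - x) + (x - s) := by abel
    have h₂ : w - s = (w - x) + (x - s) := by abel
    rw [h₁, h₂, norm_add_sq_real, norm_add_sq_real, norm_smul, real_inner_smul_left, mul_pow,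
      Real.norm_eq_abs, sq_abs]
    ring
  have h₁ := mul_le_mul_of_nonneg_left hx (mul_nonneg (zero_le_one.trans ht) (sub_nonneg.2 ht))
  have h₂ := mul_le_mul_of_nonneg_left hs (zero_le_one.trans ht)
  rw [key, key]
  linarith

/-- AFBS with backtracking stepsizes: for every `k ≥ 1`,
`h(λ^k) − h(λ∞) ≤ a²·L̄·‖λ⁰ − λ∞‖² / (2·(k + a − 1)²)`, where `L̄ = sup_k L^k`. -/
theorem afbs_backtracking_rate
    {H : Type*} [NormedAddCommGroup H] [InnerProductSpace ℝ H] [CompleteSpace H]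
    (K : Set H) (hKne : K.Nonempty) (hKcl : IsClosed K) (hKcv : Convex ℝ K)
    (h : H → ℝ) (hconv : ConvexOn ℝ Set.univ h)
    (g : H → H) (hgrad : ∀ x, HasGradientAt h (g x) x)
    (P : H → H)
    (hPmem : ∀ y, P y ∈ K)
    (hPmin : ∀ y, ∀ z ∈ K, ‖y - P y‖ ≤ ‖y - z‖)
    (a : ℝ) (ha : 2 < a)
    (Lseq : ℕ → ℝ) (hLpos : ∀ k, 0 < Lseq k) (hLmono : Monotone Lseq)
    (Lbar : ℝ) (hLbar : ∀ k, Lseq k ≤ Lbar)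
    (hLsup : Lbar = ⨆ k, Lseq k)
    (lam lamhat : ℕ → H)
    (hhat0 : lamhat 0 = lam 0)
    (hhat : ∀ k : ℕ, 1 ≤ k →
      lamhat k = lam k + (((k : ℝ) - 1) / ((k : ℝ) + a)) • (lam k - lam (k - 1)))
    (hupd : ∀ k : ℕ, lam (k + 1) = P (lamhat k - (1 / Lseq k) • g (lamhat k)))
    (hdescent : ∀ k : ℕ,
      h (lam (k + 1)) ≤ h (lamhat k) + ⟪lam (k + 1) - lamhat k, g (lamhat k)⟫ +
        Lseq k / 2 * ‖lam (k + 1) - lamhat k‖ ^ 2)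
    (laminf : H) (hinfK : laminf ∈ K) (hinfmin : ∀ z ∈ K, h laminf ≤ h z) :
    ∀ k : ℕ, 1 ≤ k →
      h (lam k) - h laminf ≤
        a ^ 2 * Lbar * ‖lam 0 - laminf‖ ^ 2 / (2 * ((k : ℝ) + a - 1) ^ 2) := by
  have hstep (n : ℕ) {z : H} (hz : z ∈ K) :
      h (lam (n + 1)) - h z ≤
        Lseq n / 2 * (‖lamhat n - z‖ ^ 2 - ‖lam (n + 1) - z‖ ^ 2) := by
    refine projected_gradient_step_le_s12 hKcv hconv (hgrad (lamhat n)) (hLpos n) ?_ ?_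
      (hdescent n) hz
    · rw [hupd]; exact hPmem _
    · rw [hupd]; exact hPmin _
  have hmem (n : ℕ) : lam (n + 1) ∈ K := by rw [hupd]; exact hPmem _
  have ha0 : 0 < a := by linarith
  have energy (n : ℕ) :
      2 / Lseq n * (((n : ℝ) + a) / a) ^ 2 * (h (lam (n + 1)) - h laminf) +
        ‖lam n + (((n : ℝ) + a) / a) • (lam (n + 1) - lam n) - laminf‖ ^ 2 ≤
      ‖lam 0 - laminf‖ ^ 2 := by
    induction n with
    | zero =>
      have hs := hstep 0 hinfK
      rw [hhat0] at hs
      have := mul_le_mul_of_nonneg_left hs (div_pos two_pos (hLpos 0)).le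
      rw [← mul_assoc, div_mul_div_cancel₀ (hLpos 0).ne', div_self two_ne_zero, one_mul] at this
      simp only [Nat.cast_zero, zero_add, div_self ha0.ne', one_pow, mul_one, one_smul,
        add_sub_cancel] at this ⊢
      linarith
    | succ n ih =>
      set t : ℝ := ((n : ℝ) + a) / a with ht
      set t' : ℝ := (((n + 1 : ℕ) : ℝ) + a) / a with ht'
      have hn : (0 : ℝ) ≤ n := n.cast_nonneg
      have htt' : t' = t + 1 / a := by rw [ht, ht']; push_cast; ring
      have ht1 : 1 ≤ t := by rw [ht, le_div_iff₀ ha0]; linarith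
      have hia : 0 < 1 / a := by positivity
      have hia2 : 1 / a ≤ 1 / 2 := one_div_le_one_div_of_le two_pos ha.le
      have ht1' : 1 ≤ t' := by linarith
      have hquad : t' ^ 2 - t' ≤ t ^ 2 := by rw [htt']; nlinarith
      have hcomb := extrapolated_step_le (vx := h (lam (n + 1)) - h laminf) ht1'
        (by simpa using hstep (n + 1) (hmem n)) (hstep (n + 1) hinfK)
      have hext : lam (n + 1) + t' • (lamhat (n + 1) - lam (n + 1)) - laminf =
          lam n + t • (lam (n + 1) - lam n) - laminf := by
        have hcoef : t' * ((((n + 1 : ℕ) : ℝ) - 1) / (((n + 1 : ℕ) : ℝ) + a)) = t - 1 := by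
          rw [ht, ht']; push_cast; field_simp; ring
        rw [hhat (n + 1) (by omega), add_sub_cancel_left, smul_smul, hcoef, Nat.add_sub_cancel,
          sub_smul, one_smul]
        abel
      rw [hext] at hcomb
      have hv : 0 ≤ h (lam (n + 1)) - h laminf := sub_nonneg.2 (hinfmin _ (hmem n))
      have hL := hLpos (n + 1)
      have hscaled := mul_le_mul_of_nonneg_left hcomb (div_pos two_pos hL).le
      rw [mul_add, ← mul_assoc _ (Lseq (n + 1) / 2), div_mul_div_cancel₀ hL.ne',
        div_self two_ne_zero, one_mul] at hscaled
      have hdecr : 2 / Lseq (n + 1) * ((t' ^ 2 - t') * (h (lam (n + 1)) - h laminf)) ≤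
          2 / Lseq n * (t ^ 2 * (h (lam (n + 1)) - h laminf)) :=
        mul_le_mul
          (div_le_div_of_nonneg_left two_pos.le (hLpos n) (hLmono n.le_succ))
          (mul_le_mul_of_nonneg_right hquad hv)
          (mul_nonneg (by nlinarith) hv) (div_pos two_pos (hLpos n)).le
      linarith
  intro k hk
  obtain ⟨n, rfl⟩ : ∃ n, k = n + 1 := ⟨k - 1, by omega⟩
  have hn : (0 : ℝ) ≤ n := n.cast_nonneg
  have hna : 0 < (n : ℝ) + a := by linarith
  have hbound : 2 / Lseq n * (((n : ℝ) + a) / a) ^ 2 * (h (lam (n + 1)) - h laminf) ≤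
      ‖lam 0 - laminf‖ ^ 2 := le_trans (le_add_of_nonneg_right (by positivity)) (energy n)
  have hcast : ((n + 1 : ℕ) : ℝ) + a - 1 = n + a := by push_cast; ring
  have hLn := hLpos n
  calc h (lam (n + 1)) - h laminf
      = a ^ 2 * Lseq n * (2 / Lseq n * (((n : ℝ) + a) / a) ^ 2 *
          (h (lam (n + 1)) - h laminf)) / (2 * ((n : ℝ) + a) ^ 2) := by field_simp
    _ ≤ a ^ 2 * Lbar * ‖lam 0 - laminf‖ ^ 2 / (2 * ((n : ℝ) + a) ^ 2) := by
        gcongr ?_ / _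
        exact (mul_le_mul_of_nonneg_left hbound (by positivity)).trans
          (by gcongr; exact hLbar n)
    _ = _ := by rw [hcast]
end
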